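/- Let n ≥ 17 be an even natural number. Then the integrality ratio of the subtour LP for the instance G(n, √(n−1)) equals (4n − 4 + 2√(n−1)) / (3n − 4 + 3√(n−1) + √n). -/

import Mathlib

open Real Filter Finset

noncomputable section

/-- Euclidean distance between two points of the plane. -/
def eucl (p q : ℝ × ℝ) : ℝ := Real.sqrt ((p.1 - q.1) ^ 2 + (p.2 - q.2) ^ 2)

/-- The points of the Euclidean TSP instance `G(n,d)`: the `3n` points
`(i, j·d)` for `i = 1,…,n` and `j = 1,2,3`, indexed by `Fin n × Fin 3`. -/
def pt (n : ℕ) (d : ℝ) (p : Fin n × Fin 3) : ℝ × ℝ :=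
  ((p.1.val : ℝ) + 1, ((p.2.val : ℝ) + 1) * d)

/-- A TSP tour of `G(n,d)`: a cyclic listing of all `3n` points (a Hamiltonian
cycle), given as a sequence `t` that hits every point exactly once in
positions `0,…,3n−1` and returns to its start at position `3n`. -/
def IsTour (n : ℕ) (t : ℕ → Fin n × Fin 3) : Prop :=
  Function.Bijective (fun i : Fin (3 * n) => t i) ∧ t (3 * n) = t 0

/-- The length of a TSP tour: the sum of the Euclidean distances between
consecutive points of the cycle. -/
def tourLength (n : ℕ) (d : ℝ) (t : ℕ → Fin n × Fin 3) : ℝ :=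
  ∑ i ∈ Finset.range (3 * n), eucl (pt n d (t i)) (pt n d (t (i + 1)))

/-- Feasibility for the subtour LP on the points of `G(n,d)`, with symmetric
edge variables `x i j`: degree constraints `∑_{j≠i} x i j = 2`, subtour
elimination constraints (each unordered pair is counted twice in the double
sum, whence the factor 2), and `0 ≤ x i j ≤ 1`. -/
def SubtourLPFeasible (n : ℕ) (x : Fin n × Fin 3 → Fin n × Fin 3 → ℝ) : Prop :=
  (∀ i j, x i j = x j i) ∧
  (∀ i, x i i = 0) ∧
  (∀ i j, 0 ≤ x i j ∧ x i j ≤ 1) ∧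
  (∀ i, ∑ j, x i j = 2) ∧
  (∀ S : Finset (Fin n × Fin 3), S.Nonempty → S ≠ Finset.univ →
      ∑ i ∈ S, ∑ j ∈ S, x i j ≤ 2 * ((S.card : ℝ) - 1))

/-- The objective value of the subtour LP for `G(n,d)`: each unordered pair
appears twice in the double sum, whence the factor `1/2`. -/
def lpValue (n : ℕ) (d : ℝ) (x : Fin n × Fin 3 → Fin n × Fin 3 → ℝ) : ℝ :=
  (1 / 2) * ∑ i, ∑ j, eucl (pt n d i) (pt n d j) * x i j

/-- The length of a shortest TSP tour of `G(n,d)`. -/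
def optTour (n : ℕ) (d : ℝ) : ℝ :=
  sInf {L | ∃ t, IsTour n t ∧ tourLength n d t = L}

/-- The optimum value of the subtour LP for `G(n,d)`. -/
def optLP (n : ℕ) (d : ℝ) : ℝ :=
  sInf {L | ∃ x, SubtourLPFeasible n x ∧ lpValue n d x = L}

/-- `zcost d z` is the length of a z-shaped path covering `z` points in the
middle row of `G(n,d)`. -/
def zcost (d x : ℝ) : ℝ := 2 * (x - 1) + Real.sqrt ((x - 1) ^ 2 + d ^ 2)

/-- `1` if exactly one of the two propositions holds, and `0` otherwise. -/
def sw (p q : Prop) [Decidable p] [Decidable q] : ℕ := if (p ↔ q) then 0 else 1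

lemma sum_sw_le (a b n : ℕ) (ha : a < n) (hb : b < n) :
    (∑ i ∈ range (n - 1), (sw (a ≤ i) (b ≤ i) : ℝ)) = |(a : ℝ) - b| := by
  wlog h : a ≤ b generalizing a b
  · rw [abs_sub_comm, ← this b a hb ha (by omega)]
    refine sum_congr rfl fun i _ => ?_
    simp only [sw, iff_comm]
  have h1 : ∀ i ∈ range (n - 1), (sw (a ≤ i) (b ≤ i) : ℝ) = if i ∈ Ico a b then 1 else 0 := by
    intro i _
    simp only [sw, mem_Ico]
    split_ifs <;> first | (exfalso; omega) | simp
  have h2 : (range (n - 1)).filter (fun i => i ∈ Ico a b) = Ico a b := by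
    ext i
    simp only [mem_filter, mem_range, mem_Ico]
    omega
  rw [sum_congr rfl h1, ← sum_filter, h2, sum_const, Nat.card_Ico, nsmul_one, Nat.cast_sub h,
    abs_sub_comm, abs_of_nonneg]
  have : (a : ℝ) ≤ b := by exact_mod_cast h
  linarith

section Switches

variable (σ : ℕ → Prop) [DecidablePred σ]

lemma one_le_sum_sw {a b : ℕ} (hab : a ≤ b) (h : ¬(σ a ↔ σ b)) :
    1 ≤ ∑ i ∈ Ico a b, sw (σ i) (σ (i + 1)) := by
  induction b, hab using Nat.le_induction with
  | base => simp at h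
  | succ b hb ih =>
    rw [sum_Ico_succ_top hb]
    by_cases h1 : σ a ↔ σ b
    · have : sw (σ b) (σ (b + 1)) = 1 := by
        rw [sw, if_neg]
        tauto
      omega
    · exact (ih h1).trans (Nat.le_add_right _ _)

lemma two_le_sum_sw {a b c : ℕ} (hac : a ≤ c) (hcb : c ≤ b) (h : σ a ↔ σ b)
    (hc : ¬(σ a ↔ σ c)) : 2 ≤ ∑ i ∈ Ico a b, sw (σ i) (σ (i + 1)) := by
  rw [← sum_Ico_consecutive _ hac hcb]
  have h1 := one_le_sum_sw σ hac hc
  have h2 := one_le_sum_sw σ hcb (by tauto)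
  omega

lemma even_sum_sw (N : ℕ) :
    Even (∑ i ∈ range N, sw (σ i) (σ (i + 1))) ↔ (σ 0 ↔ σ N) := by
  induction N with
  | zero => simp
  | succ N ih =>
    rw [sum_range_succ, Nat.even_add, ih, sw]
    split_ifs with h
    · simp only [Even.zero, iff_true]; tauto
    · simp only [Nat.not_even_one, iff_false]; tauto

end Switches

section ClosedWalk

/-- `g r i`: the number of steps inside row `r` that cross the vertical line between the columns
`i` and `i + 1`, for a closed walk of length `N` with columns `C` and rows `R`. -/
def rowCross (N : ℕ) (C R : ℕ → ℕ) (r i : ℕ) : ℕ :=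
  ∑ k ∈ range N, if R k = r ∧ R (k + 1) = r then sw (C k ≤ i) (C (k + 1) ≤ i) else 0

/-- The number of row-changing steps that cross the vertical line between columns `i`, `i + 1`. -/
def diagCross (N : ℕ) (C R : ℕ → ℕ) (i : ℕ) : ℕ :=
  ∑ k ∈ range N, if R k = R (k + 1) then 0 else sw (C k ≤ i) (C (k + 1) ≤ i)

/-- The number of row-changing steps. -/
def rowChanges (N : ℕ) (R : ℕ → ℕ) : ℕ :=
  ∑ k ∈ range N, if R k = R (k + 1) then 0 else 1

variable {n N : ℕ} {C R : ℕ → ℕ}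

lemma sum_rowCross_add_diagCross (hR : ∀ k, R k < 3) (i : ℕ) :
    rowCross N C R 0 i + rowCross N C R 1 i + rowCross N C R 2 i + diagCross N C R i =
      ∑ k ∈ range N, sw (C k ≤ i) (C (k + 1) ≤ i) := by
  simp only [rowCross, diagCross, ← sum_add_distrib]
  refine sum_congr rfl fun k _ => ?_
  have := hR k
  have := hR (k + 1)
  split_ifs <;> omega

/-- Every set of grid points met and missed by the closed walk is entered or left twice. -/
def CutCondition (n N : ℕ) (C R : ℕ → ℕ) : Prop :=
  ∀ (s : ℕ → ℕ → Prop) [∀ a b, Decidable (s a b)],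
    (∃ a < n, ∃ b < 3, s a b) → (∃ a < n, ∃ b < 3, ¬ s a b) →
      2 ≤ ∑ k ∈ range N, sw (s (C k) (R k)) (s (C (k + 1)) (R (k + 1)))

/-- The number of steps between row `r` and another row, with the endpoint in row `r` in one of the
first `m` columns. -/
def exits (N : ℕ) (C R : ℕ → ℕ) (r m : ℕ) : ℕ :=
  ∑ k ∈ range N, if (R k = r ∧ R (k + 1) ≠ r ∧ C k < m) ∨ (R (k + 1) = r ∧ R k ≠ r ∧ C (k + 1) < m)
    then 1 else 0

lemma exits_add_two_le (H : CutCondition n N C R) {r a b : ℕ} (hr : r < 3) (hab : a < b)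
    (hbn : b ≤ n) (ha : ∀ k ∈ range N, R k = r → R (k + 1) = r → (C k < a ↔ C (k + 1) < a))
    (hb : ∀ k ∈ range N, R k = r → R (k + 1) = r → (C k < b ↔ C (k + 1) < b)) :
    exits N C R r a + 2 ≤ exits N C R r b := by
  have h2 := H (fun c ρ => ρ = r ∧ a ≤ c ∧ c < b) ⟨a, by omega, r, hr, rfl, le_rfl, hab⟩
    (by
      by_cases h0 : r = 0
      · exact ⟨0, by omega, 1, by norm_num, by omega⟩
      · exact ⟨0, by omega, 0, by norm_num, by omega⟩)
  refine (Nat.add_le_add_left h2 _).trans ?_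
  simp only [exits, ← sum_add_distrib]
  refine sum_le_sum fun k hk => ?_
  have h3 := ha k hk
  have h4 := hb k hk
  simp only [sw]
  split_ifs <;> omega

lemma exists_exits_ge (H : CutCondition n N C R) {r : ℕ} (hr : r < 3) (m : ℕ) (hm : m < n) :
    ∃ a ≤ m, (∀ k ∈ range N, R k = r → R (k + 1) = r → (C k < a ↔ C (k + 1) < a)) ∧
      2 * ∑ i ∈ range m, (if rowCross N C R r i = 0 then 1 else 0) ≤ exits N C R r a := by
  induction m with
  | zero => exact ⟨0, le_rfl, by simp, by simp⟩
  | succ m ih =>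
    obtain ⟨a, ham, ha, hle⟩ := ih (by omega)
    rw [sum_range_succ]
    split_ifs with h
    · refine ⟨m + 1, le_rfl, ?_, ?_⟩
      · intro k hk h1 h2
        have h3 := sum_eq_zero_iff.1 h k hk
        rw [if_pos ⟨h1, h2⟩, sw] at h3
        split_ifs at h3
        omega
      · refine le_trans ?_ (exits_add_two_le H hr (by omega) hm.le ha ?_)
        · omega
        · intro k hk h1 h2
          have h3 := sum_eq_zero_iff.1 h k hk
          rw [if_pos ⟨h1, h2⟩, sw] at h3
          split_ifs at h3
          omega
    · exact ⟨a, by omega, ha, by omega⟩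

/-- A row with `γ` vertical lines not crossed inside it has at least `2 (γ + 1)` exits. -/
lemma exits_ge (hn : 0 < n) (hC : ∀ k, C k < n) (H : CutCondition n N C R) {r : ℕ} (hr : r < 3) :
    2 * ∑ i ∈ range (n - 1), (if rowCross N C R r i = 0 then 1 else 0) + 2 ≤ exits N C R r n := by
  obtain ⟨a, ham, ha, hle⟩ := exists_exits_ge H hr (n - 1) (by omega)
  exact (Nat.add_le_add_right hle 2).trans
    (exits_add_two_le H hr (by omega) le_rfl ha fun k _ _ _ => by simp [hC])

lemma sum_exits (hC : ∀ k, C k < n) (hR : ∀ k, R k < 3) :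
    exits N C R 0 n + exits N C R 1 n + exits N C R 2 n = 2 * rowChanges N R := by
  simp only [exits, rowChanges, ← sum_add_distrib, mul_sum]
  refine sum_congr rfl fun k _ => ?_
  have := hR k
  have := hR (k + 1)
  have := hC k
  have := hC (k + 1)
  split_ifs <;> omega

/-- The number of rows without a step crossing the vertical line `i`. -/
def gaps (N : ℕ) (C R : ℕ → ℕ) (i : ℕ) : ℕ :=
  (if rowCross N C R 0 i = 0 then 1 else 0) + (if rowCross N C R 1 i = 0 then 1 else 0) +
    (if rowCross N C R 2 i = 0 then 1 else 0)

lemma rowChanges_ge (hn : 0 < n) (hC : ∀ k, C k < n) (hR : ∀ k, R k < 3)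
    (H : CutCondition n N C R) :
    ∑ i ∈ range (n - 1), gaps N C R i + 3 ≤ rowChanges N R := by
  have h0 := exits_ge hn hC H (r := 0) (by norm_num)
  have h1 := exits_ge hn hC H (r := 1) (by norm_num)
  have h2 := exits_ge hn hC H (r := 2) (by norm_num)
  have h3 := sum_exits (N := N) hC hR
  simp only [gaps, sum_add_distrib]
  omega

/-- The weighted number of crossings of a vertical line is bounded below in terms of its gaps. -/
lemma line_cost_ge {l : ℝ} (hl0 : 0 ≤ l) (hl1 : l ≤ 1) {g₀ g₁ g₂ x γ : ℕ}
    (hγ : γ = (if g₀ = 0 then 1 else 0) + (if g₁ = 0 then 1 else 0) + (if g₂ = 0 then 1 else 0))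
    (he : Even (g₀ + g₁ + g₂ + x)) (h2 : 2 ≤ g₀ + g₁ + g₂ + x) :
    3 + l - γ * (1 + l) + (if 5 ≤ g₀ + g₁ + g₂ + x then l else 0) ≤
      ((g₀ + g₁ + g₂ : ℕ) : ℝ) + l * x := by
  have hG : 3 ≤ g₀ + g₁ + g₂ + γ := by rw [hγ]; split_ifs <;> omega
  have hγ3 : γ ≤ 3 := by rw [hγ]; split_ifs <;> omega
  generalize g₀ + g₁ + g₂ = G at *
  have hG' : (3 : ℝ) ≤ G + γ := by exact_mod_cast hG
  split_ifs with h5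
  · have h6 : 6 ≤ G + x := by
      obtain ⟨m, hm⟩ := he
      omega
    have h6' : (6 : ℝ) ≤ G + x := by exact_mod_cast h6
    have : (0 : ℝ) ≤ γ := by positivity
    nlinarith [mul_nonneg (sub_nonneg.2 hl1) (sub_nonneg.2 hG'),
      mul_nonneg hl0 (sub_nonneg.2 h6'), mul_nonneg hl0 this]
  · obtain ⟨m, hm⟩ := he
    have h2' : (2 : ℝ) ≤ G + x := by exact_mod_cast h2
    have hx : (0 : ℝ) ≤ x := by positivity
    have hGn : (0 : ℝ) ≤ G := by positivity
    have hlx := mul_nonneg hl0 hx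
    interval_cases γ
    · rcases Nat.eq_zero_or_pos x with rfl | hx
      · have : (4 : ℝ) ≤ G := by exact_mod_cast (by omega : 4 ≤ G)
        push_cast
        linarith
      · have : (1 : ℝ) ≤ x := by exact_mod_cast hx
        push_cast at *
        nlinarith
    all_goals push_cast at *; linarith

/-- If at most four steps cross the vertical line `j`, some row-changing step stays to its left. -/
lemma exists_rowChange_left (hR : ∀ k, R k < 3) (H : CutCondition n N C R) {j : ℕ} (hj : j + 1 < n)
    (h : ∑ k ∈ range N, sw (C k ≤ j) (C (k + 1) ≤ j) < 5) :
    ∃ k ∈ range N, R k ≠ R (k + 1) ∧ C k ≤ j ∧ C (k + 1) ≤ j := by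
  by_contra! hcon
  have h0 : ∀ r < 3, 2 ≤ ∑ k ∈ range N,
      sw (R k = r ∧ C k ≤ j) (R (k + 1) = r ∧ C (k + 1) ≤ j) := fun r hr =>
    H (fun c ρ => ρ = r ∧ c ≤ j) ⟨0, by omega, r, hr, rfl, by omega⟩
      ⟨j + 1, hj, r, hr, by omega⟩
  have h1 := add_le_add (add_le_add (h0 0 (by norm_num)) (h0 1 (by norm_num))) (h0 2 (by norm_num))
  simp only [← sum_add_distrib] at h1
  refine absurd (h1.trans (sum_le_sum fun k hk => ?_)) (not_le.2 (h.trans (by norm_num)))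
  have h2 := hcon k hk
  have := hR k
  have := hR (k + 1)
  simp only [sw]
  by_cases h3 : R k = R (k + 1)
  · split_ifs <;> omega
  · have h4 := h2 h3
    split_ifs <;> omega

lemma exists_rowChange_right (hR : ∀ k, R k < 3) (H : CutCondition n N C R) {j : ℕ}
    (hj : j + 1 < n) (h : ∑ k ∈ range N, sw (C k ≤ j) (C (k + 1) ≤ j) < 5) :
    ∃ k ∈ range N, R k ≠ R (k + 1) ∧ j < C k ∧ j < C (k + 1) := by
  by_contra! hcon
  have h0 : ∀ r < 3, 2 ≤ ∑ k ∈ range N,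
      sw (R k = r ∧ j < C k) (R (k + 1) = r ∧ j < C (k + 1)) := fun r hr =>
    H (fun c ρ => ρ = r ∧ j < c) ⟨j + 1, hj, r, hr, rfl, by omega⟩
      ⟨0, by omega, r, hr, by omega⟩
  have h1 := add_le_add (add_le_add (h0 0 (by norm_num)) (h0 1 (by norm_num))) (h0 2 (by norm_num))
  simp only [← sum_add_distrib] at h1
  refine absurd (h1.trans (sum_le_sum fun k hk => ?_)) (not_le.2 (h.trans (by norm_num)))
  have h2 := hcon k hk
  have := hR k
  have := hR (k + 1)
  simp only [sw]
  by_cases h3 : R k = R (k + 1)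
  · split_ifs <;> omega
  · have h4 := h2 h3
    split_ifs <;> omega

lemma sum_base_eq (hC : ∀ k, C k < n) (hR : ∀ k, R k < 3) (l μ : ℝ) :
    ∑ k ∈ range N, (if R k = R (k + 1) then |(C k : ℝ) - C (k + 1)|
        else l * |(C k : ℝ) - C (k + 1)| + μ) =
      ∑ i ∈ range (n - 1), (((rowCross N C R 0 i + rowCross N C R 1 i + rowCross N C R 2 i : ℕ) : ℝ)
        + l * diagCross N C R i) + μ * rowChanges N R := by
  simp only [rowCross, diagCross, rowChanges, Nat.cast_sum, ← sum_add_distrib, mul_sum]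
  rw [sum_comm, ← sum_add_distrib]
  refine sum_congr rfl fun k _ => ?_
  rw [← sum_sw_le _ _ n (hC k) (hC (k + 1))]
  have h1 := hR k
  have h2 := hR (k + 1)
  generalize R k = a at *
  generalize R (k + 1) = b at *
  interval_cases a <;> interval_cases b <;> simp [mul_sum]

lemma sum_base_ge (hn : 0 < n) (hC : ∀ k, C k < n) (hR : ∀ k, R k < 3)
    (H : CutCondition n N C R) (hCN : C N = C 0) {l : ℝ} (hl0 : 0 ≤ l) (hl1 : l ≤ 1) :
    ((n : ℝ) - 1) * (3 + l) + 3 * (1 + l) +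
        l * #{i ∈ range (n - 1) | 5 ≤ ∑ k ∈ range N, sw (C k ≤ i) (C (k + 1) ≤ i)} ≤
      ∑ k ∈ range N, (if R k = R (k + 1) then |(C k : ℝ) - C (k + 1)|
        else l * |(C k : ℝ) - C (k + 1)| + (1 + l)) := by
  have hline : ∀ i ∈ range (n - 1), 3 + l - gaps N C R i * (1 + l) +
      (if 5 ≤ ∑ k ∈ range N, sw (C k ≤ i) (C (k + 1) ≤ i) then l else 0) ≤
      ((rowCross N C R 0 i + rowCross N C R 1 i + rowCross N C R 2 i : ℕ) : ℝ)
        + l * diagCross N C R i := by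
    intro i hi
    rw [mem_range] at hi
    rw [← sum_rowCross_add_diagCross hR i]
    refine line_cost_ge hl0 hl1 rfl ?_ ?_ <;> rw [sum_rowCross_add_diagCross hR i]
    · exact (even_sum_sw (fun k => C k ≤ i) N).2 (by rw [hCN])
    · exact H (fun c _ => c ≤ i) ⟨0, hn, 0, by norm_num, by omega⟩
        ⟨n - 1, by omega, 0, by norm_num, by omega⟩
  have h1 := sum_le_sum hline
  rw [sum_base_eq hC hR]
  have h2 : ((∑ i ∈ range (n - 1), gaps N C R i + 3 : ℕ) : ℝ) ≤ rowChanges N R := by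
    exact_mod_cast rowChanges_ge hn hC hR H
  rw [sum_add_distrib, sum_sub_distrib, ← sum_mul, ← sum_filter, sum_const, sum_const, card_range,
    nsmul_eq_mul, nsmul_eq_mul, Nat.cast_sub hn] at h1
  rw [Nat.cast_one] at h1
  push_cast at h2
  nlinarith [mul_le_mul_of_nonneg_left h2 (by linarith : 0 ≤ 1 + l)]

/-- A lower bound for the length of a closed walk meeting all cuts, where row-changing steps have
length at least `d` and at least an affine function of their horizontal extent. -/
lemma sum_length_ge (hn : 0 < n) (hC : ∀ k, C k < n) (hR : ∀ k, R k < 3)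
    (H : CutCondition n N C R) (hCN : C N = C 0) {l d : ℝ} (hl0 : 0 ≤ l) (hl1 : l ≤ 1)
    (hd : 2 * (d - (1 + l)) ≤ l * (n - 1)) {len : ℕ → ℝ}
    (hrow : ∀ k, R k = R (k + 1) → |(C k : ℝ) - C (k + 1)| ≤ len k)
    (haff : ∀ k, R k ≠ R (k + 1) → l * |(C k : ℝ) - C (k + 1)| + (1 + l) ≤ len k)
    (hlen : ∀ k, R k ≠ R (k + 1) → d ≤ len k) :
    ((n : ℝ) - 1) * (3 + l) + 1 + l + 2 * d ≤ ∑ k ∈ range N, len k := by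
  have hbase := sum_base_ge hn hC hR H hCN hl0 hl1
  set c : ℕ → ℕ := fun i => ∑ k ∈ range N, sw (C k ≤ i) (C (k + 1) ≤ i) with hc
  set base : ℕ → ℝ := fun k => if R k = R (k + 1) then |(C k : ℝ) - C (k + 1)|
        else l * |(C k : ℝ) - C (k + 1)| + (1 + l) with hbase_def
  have hle : ∀ k, base k ≤ len k := by
    intro k
    simp only [hbase_def]
    split_ifs with h
    · exact hrow k h
    · exact haff k h
  have hcard : #{i ∈ range (n - 1) | c i < 5} + #{i ∈ range (n - 1) | 5 ≤ c i} = n - 1 := by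
    have := card_filter_add_card_filter_not (s := range (n - 1)) (fun i => c i < 5)
    simpa only [not_lt, card_range] using this
  rcases (filter (fun i => c i < 5) (range (n - 1))).eq_empty_or_nonempty with hF | hF
  · rw [hF, card_empty, zero_add] at hcard
    change _ + l * ((#{i ∈ range (n - 1) | 5 ≤ c i} : ℕ) : ℝ) ≤ _ at hbase
    rw [hcard, Nat.cast_sub hn] at hbase
    have := sum_le_sum fun k (_ : k ∈ range N) => hle k
    push_cast at hbase
    linarith
  · obtain ⟨a, ha⟩ : ∃ a, a = (filter (fun i => c i < 5) (range (n - 1))).min' hF := ⟨_, rfl⟩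
    obtain ⟨b, hb⟩ : ∃ b, b = (filter (fun i => c i < 5) (range (n - 1))).max' hF := ⟨_, rfl⟩
    have ha' := min'_mem _ hF
    have hb' := max'_mem _ hF
    have hab := min'_le_max' _ hF
    have hsub : filter (fun i => c i < 5) (range (n - 1)) ⊆ Icc a b := fun i hi =>
      mem_Icc.2 ⟨ha ▸ min'_le _ _ hi, hb ▸ le_max' _ _ hi⟩
    rw [← ha] at ha' hab
    rw [← hb] at hb' hab
    rw [mem_filter, mem_range] at ha' hb'
    have hcard' := card_le_card hsub
    rw [Nat.card_Icc] at hcard'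
    obtain ⟨k₁, hk₁, hk₁R, hk₁C, hk₁C'⟩ := exists_rowChange_left hR H (by omega) ha'.2
    obtain ⟨k₂, hk₂, hk₂R, hk₂C, hk₂C'⟩ := exists_rowChange_right hR H (by omega) hb'.2
    have hne : k₁ ≠ k₂ := by
      rintro rfl
      omega
    have hpair : ∑ k ∈ {k₁, k₂}, (len k - base k) ≤ ∑ k ∈ range N, (len k - base k) :=
      sum_le_sum_of_subset_of_nonneg (by
        intro k hk
        rcases mem_insert.1 hk with rfl | hk
        · exact hk₁
        · rwa [mem_singleton.1 hk]) fun k _ _ => sub_nonneg.2 (hle k)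
    rw [sum_pair hne, sum_sub_distrib] at hpair
    simp only [hbase_def, if_neg hk₁R, if_neg hk₂R] at hpair
    have hx₁ : |(C k₁ : ℝ) - C (k₁ + 1)| ≤ a := by
      have h1 : (C k₁ : ℝ) ≤ a := by exact_mod_cast hk₁C
      have h2 : (C (k₁ + 1) : ℝ) ≤ a := by exact_mod_cast hk₁C'
      rw [abs_le]
      constructor <;> linarith [(C k₁).cast_nonneg (α := ℝ), (C (k₁ + 1)).cast_nonneg (α := ℝ)]
    have hx₂ : |(C k₂ : ℝ) - C (k₂ + 1)| ≤ n - 2 - b := by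
      have h1 : (b : ℝ) + 1 ≤ C k₂ := by exact_mod_cast hk₂C
      have h2 : (b : ℝ) + 1 ≤ C (k₂ + 1) := by exact_mod_cast hk₂C'
      have h3 : (C k₂ : ℝ) + 1 ≤ n := by exact_mod_cast hC k₂
      have h4 : (C (k₂ + 1) : ℝ) + 1 ≤ n := by exact_mod_cast hC (k₂ + 1)
      rw [abs_le]
      constructor <;> linarith
    have hnum : (a : ℝ) + (n - 2 - b) ≤ #{i ∈ range (n - 1) | 5 ≤ c i} := by
      have : a + n ≤ #{i ∈ range (n - 1) | 5 ≤ c i} + 2 + b := by omega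
      have : (a : ℝ) + n ≤ #{i ∈ range (n - 1) | 5 ≤ c i} + 2 + b := by exact_mod_cast this
      linarith
    have h1 := hlen k₁ hk₁R
    have h2 := hlen k₂ hk₂R
    have h3 := mul_le_mul_of_nonneg_left hx₁ hl0
    have h4 := mul_le_mul_of_nonneg_left hx₂ hl0
    have h5 := mul_le_mul_of_nonneg_left hnum hl0
    change _ + l * ((#{i ∈ range (n - 1) | 5 ≤ c i} : ℕ) : ℝ) ≤ _ at hbase
    linarith

end ClosedWalk

section Tour

variable {n : ℕ} {t : ℕ → Fin n × Fin 3}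

lemma IsTour.cutCondition (ht : IsTour n t) :
    CutCondition n (3 * n) (fun k => (t k).1) (fun k => (t k).2) := by
  rintro s _ ⟨a, ha, b, hb, hab⟩ ⟨a', ha', b', hb', hab'⟩
  obtain ⟨k, hk⟩ := ht.1.2 (⟨a, ha⟩, ⟨b, hb⟩)
  obtain ⟨k', hk'⟩ := ht.1.2 (⟨a', ha'⟩, ⟨b', hb'⟩)
  have h1 : s (t k).1 (t k).2 := by
    simp only at hk
    simpa [hk] using hab
  have h2 : ¬ s (t k').1 (t k').2 := by
    simp only at hk'
    simpa [hk'] using hab'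
  have h3 : s (t 0).1 (t 0).2 ↔ s (t (3 * n)).1 (t (3 * n)).2 := by rw [ht.2]
  rw [range_eq_Ico]
  by_cases h0 : s (t 0).1 (t 0).2
  · exact two_le_sum_sw (fun k => s (t k).1 (t k).2) (Nat.zero_le k') k'.2.le h3 (by tauto)
  · exact two_le_sum_sw (fun k => s (t k).1 (t k).2) (Nat.zero_le k) k.2.le h3 (by tauto)

lemma eucl_pt (d : ℝ) (p q : Fin n × Fin 3) :
    eucl (pt n d p) (pt n d q) =
      √(((p.1 : ℕ) - (q.1 : ℕ) : ℝ) ^ 2 + (((p.2 : ℕ) - (q.2 : ℕ) : ℝ) * d) ^ 2) := by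
  simp only [eucl, pt]
  congr 1
  ring

lemma one_le_sq_natCast_sub {a b : ℕ} (h : a ≠ b) : (1 : ℝ) ≤ ((a : ℝ) - b) ^ 2 := by
  have h1 : (1 : ℤ) ≤ |(a : ℤ) - b| := Int.one_le_abs (by omega)
  have h2 : (1 : ℤ) ≤ ((a : ℤ) - b) ^ 2 := by
    rw [← sq_abs]
    nlinarith
  exact_mod_cast h2

lemma IsTour.le_tourLength (ht : IsTour n t) (hn : 17 ≤ n) :
    4 * (n : ℝ) - 4 + 2 * √((n : ℝ) - 1) ≤ tourLength n √((n : ℝ) - 1) t := by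
  have hn' : (17 : ℝ) ≤ n := by exact_mod_cast hn
  set d := √((n : ℝ) - 1) with hd
  have hd2 : d ^ 2 = n - 1 := Real.sq_sqrt (by linarith)
  have hd4 : 4 ≤ d := Real.le_sqrt_of_sq_le (by linarith)
  obtain ⟨l, hl⟩ : ∃ l : ℝ, l * n = n - 2 := ⟨(n - 2) / n, by field_simp⟩
  have hl0 : 15 / 17 ≤ l := by nlinarith
  have hl1 : l ≤ 1 := by nlinarith
  have hrow2 : ∀ p q : Fin n × Fin 3, (p.2 : ℕ) ≠ q.2 →
      ((p.1 : ℕ) - (q.1 : ℕ) : ℝ) ^ 2 + d ^ 2 ≤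
        ((p.1 : ℕ) - (q.1 : ℕ) : ℝ) ^ 2 + (((p.2 : ℕ) - (q.2 : ℕ) : ℝ) * d) ^ 2 := by
    intro p q h
    rw [mul_pow]
    nlinarith [one_le_sq_natCast_sub h, sq_nonneg d]
  have key := sum_length_ge (N := 3 * n) (C := fun k => (t k).1) (R := fun k => (t k).2)
    (l := l) (d := d) (len := fun k => eucl (pt n d (t k)) (pt n d (t (k + 1)))) (by omega)
    (fun k => (t k).1.2) (fun k => (t k).2.2) ht.cutCondition (by simp only [ht.2])
    (by linarith) hl1 (by nlinarith)
    (fun k _ => by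
      rw [eucl_pt]
      exact Real.abs_le_sqrt (le_add_of_nonneg_right (sq_nonneg _)))
    (fun k hk => by
      rw [eucl_pt]
      refine Real.le_sqrt_of_sq_le (le_trans ?_ (hrow2 _ _ hk))
      rw [← sq_abs (_ - _ : ℝ), hd2]
      obtain ⟨A, hA⟩ : ∃ A, A = |(((t k).1 : ℕ) - ((t (k + 1)).1 : ℕ) : ℝ)| := ⟨_, rfl⟩
      rw [← hA]
      refine le_of_mul_le_mul_right (?_ : _ * (n : ℝ) ^ 2 ≤ _ * (n : ℝ) ^ 2) (by positivity)
      have : (l * A + (1 + l)) ^ 2 * (n : ℝ) ^ 2 = (l * n * A + (n + l * n)) ^ 2 := by ring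
      rw [this, hl]
      nlinarith [mul_nonneg (by linarith : (0 : ℝ) ≤ n - 1) (sq_nonneg (2 * A - n + 2))])
    (fun k hk => by
      rw [eucl_pt]
      refine Real.le_sqrt_of_sq_le (le_trans ?_ (hrow2 _ _ hk))
      exact le_add_of_nonneg_left (sq_nonneg _))
  refine le_trans (le_of_eq ?_) key
  linear_combination -hl

/-- An optimal tour of `G(n, √(n - 1))` for `n = 2 m`: it traverses the first row, then the right
half of the second row, the third row, and the left half of the second row. -/
def zTour (m : ℕ) (hm : 0 < m) (k : ℕ) : Fin (2 * m) × Fin 3 :=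
  if k < 2 * m then (⟨k % (2 * m), Nat.mod_lt _ (by omega)⟩, 0)
  else if k < 3 * m then (⟨(4 * m - 1 - k) % (2 * m), Nat.mod_lt _ (by omega)⟩, 1)
  else if k < 5 * m then (⟨(5 * m - 1 - k) % (2 * m), Nat.mod_lt _ (by omega)⟩, 2)
  else if k < 6 * m then (⟨(6 * m - 1 - k) % (2 * m), Nat.mod_lt _ (by omega)⟩, 1)
  else (⟨0, by omega⟩, 0)

lemma zTour_col {m : ℕ} (hm : 0 < m) (k : ℕ) : ((zTour m hm k).1 : ℕ) =
    if k < 2 * m then k else if k < 3 * m then 4 * m - 1 - k else if k < 5 * m then 5 * m - 1 - k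
      else if k < 6 * m then 6 * m - 1 - k else 0 := by
  unfold zTour
  split_ifs <;> first | rfl | exact Nat.mod_eq_of_lt (by omega)

lemma zTour_row {m : ℕ} (hm : 0 < m) (k : ℕ) : ((zTour m hm k).2 : ℕ) =
    if k < 2 * m then 0 else if k < 3 * m then 1 else if k < 5 * m then 2
      else if k < 6 * m then 1 else 0 := by
  unfold zTour
  split_ifs <;> rfl

lemma isTour_zTour {m : ℕ} (hm : 0 < m) : IsTour (2 * m) (zTour m hm) := by
  constructor
  · rw [Fintype.bijective_iff_injective_and_card]
    refine ⟨fun i j h => ?_, by simp [mul_comm]⟩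
    have h1 := congrArg (fun p => (p.1 : ℕ)) h
    have h2 := congrArg (fun p => (p.2 : ℕ)) h
    simp only [zTour_col, zTour_row] at h1 h2
    have := i.2
    have := j.2
    ext
    split_ifs at h1 h2 <;> omega
  · ext
    · simp only [zTour_col]
      split_ifs <;> omega
    · simp only [zTour_row]
      split_ifs <;> omega

lemma zTour_step {m : ℕ} (hm : 0 < m) {k : ℕ} (hk : k < 3 * (2 * m)) :
    (((zTour m hm k).2 : ℕ) = (zTour m hm (k + 1)).2 ∧
      (((zTour m hm k).1 : ℕ) = (zTour m hm (k + 1)).1 + 1 ∨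
        ((zTour m hm (k + 1)).1 : ℕ) = (zTour m hm k).1 + 1)) ∨
    ((k = 2 * m - 1 ∨ k = 6 * m - 1) ∧
      (((zTour m hm k).2 : ℕ) = (zTour m hm (k + 1)).2 + 1 ∨
        ((zTour m hm (k + 1)).2 : ℕ) = (zTour m hm k).2 + 1) ∧
      ((zTour m hm k).1 : ℕ) = (zTour m hm (k + 1)).1) ∨
    ((k = 3 * m - 1 ∨ k = 5 * m - 1) ∧
      (((zTour m hm k).2 : ℕ) = (zTour m hm (k + 1)).2 + 1 ∨
        ((zTour m hm (k + 1)).2 : ℕ) = (zTour m hm k).2 + 1) ∧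
      ((zTour m hm (k + 1)).1 : ℕ) + 1 = (zTour m hm k).1 + m) := by
  rw [zTour_col, zTour_col, zTour_row, zTour_row]
  split_ifs <;> omega

lemma tourLength_zTour_le {m : ℕ} (hm : 0 < m) :
    tourLength (2 * m) √((2 * m : ℕ) - 1 : ℝ) (zTour m hm) ≤
      4 * ((2 * m : ℕ) : ℝ) - 4 + 2 * √((2 * m : ℕ) - 1 : ℝ) := by
  have hm1 : (1 : ℝ) ≤ m := by exact_mod_cast hm
  set d := √((2 * m : ℕ) - 1 : ℝ) with hd
  have hd2 : d ^ 2 = 2 * m - 1 := by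
    rw [hd, Real.sq_sqrt] <;> push_cast <;> linarith
  have hd1 : 1 ≤ d := Real.le_sqrt_of_sq_le (by push_cast; linarith)
  have hstep : ∀ k ∈ range (3 * (2 * m)),
      eucl (pt (2 * m) d (zTour m hm k)) (pt (2 * m) d (zTour m hm (k + 1))) ≤
        1 + (if k = 2 * m - 1 then d - 1 else 0) + (if k = 6 * m - 1 then d - 1 else 0) +
          (if k = 3 * m - 1 then (m : ℝ) - 1 else 0) + (if k = 5 * m - 1 then (m : ℝ) - 1 else 0) := by
    intro k hk
    rw [mem_range] at hk
    have h1 : 0 ≤ (if k = 2 * m - 1 then d - 1 else 0) := by split_ifs <;> linarith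
    have h2 : 0 ≤ (if k = 6 * m - 1 then d - 1 else 0) := by split_ifs <;> linarith
    have h3 : 0 ≤ (if k = 3 * m - 1 then (m : ℝ) - 1 else 0) := by split_ifs <;> linarith
    have h4 : 0 ≤ (if k = 5 * m - 1 then (m : ℝ) - 1 else 0) := by split_ifs <;> linarith
    have hrow : ∀ r r' : ℕ, r = r' + 1 ∨ r' = r + 1 → (((r : ℝ) - r') * d) ^ 2 = 2 * m - 1 := by
      rintro r r' (rfl | rfl) <;> push_cast <;> rw [← hd2] <;> ring
    rw [eucl_pt]
    refine Real.sqrt_le_iff.2 ⟨by linarith, ?_⟩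
    rcases zTour_step hm hk with ⟨hr, hc⟩ | ⟨hk, hr, hc⟩ | ⟨hk, hr, hc⟩
    · rw [hr, sub_self, zero_mul]
      have : (((zTour m hm k).1 : ℕ) - ((zTour m hm (k + 1)).1 : ℕ) : ℝ) ^ 2 = 1 := by
        rcases hc with hc | hc <;> rw [hc] <;> push_cast <;> ring
      rw [this]
      nlinarith
    · rw [hrow _ _ hr, hc, sub_self, ← hd2]
      have : d ≤ 1 + (if k = 2 * m - 1 then d - 1 else 0) + (if k = 6 * m - 1 then d - 1 else 0) := by
        rcases hk with hk | hk
        · rw [if_pos hk]; linarith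
        · rw [if_pos hk]; linarith
      nlinarith
    · rw [hrow _ _ hr]
      have hc' : (((zTour m hm (k + 1)).1 : ℕ) : ℝ) = ((zTour m hm k).1 : ℕ) + m - 1 := by
        have : (((zTour m hm (k + 1)).1 : ℕ) : ℝ) + 1 = ((zTour m hm k).1 : ℕ) + m := by
          exact_mod_cast hc
        linarith
      have : (m : ℝ) ≤ 1 + (if k = 3 * m - 1 then (m : ℝ) - 1 else 0) +
          (if k = 5 * m - 1 then (m : ℝ) - 1 else 0) := by
        rcases hk with hk | hk
        · rw [if_pos hk]; linarith
        · rw [if_pos hk]; linarith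
      rw [hc']
      nlinarith
  refine (sum_le_sum hstep).trans (le_of_eq ?_)
  simp only [sum_add_distrib, sum_ite_eq', mem_range]
  rw [if_pos (by omega), if_pos (by omega), if_pos (by omega), if_pos (by omega)]
  simp
  ring

lemma optTour_eq (hn : 17 ≤ n) (hne : Even n) :
    optTour n √((n : ℝ) - 1) = 4 * (n : ℝ) - 4 + 2 * √((n : ℝ) - 1) := by
  obtain ⟨m, rfl⟩ := hne.two_dvd
  have hm : 0 < m := by omega
  have htour := isTour_zTour hm
  refine IsLeast.csInf_eq ⟨⟨_, htour, le_antisymm (tourLength_zTour_le hm)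
    (htour.le_tourLength hn)⟩, ?_⟩
  rintro _ ⟨t, ht, rfl⟩
  exact ht.le_tourLength hn

end Tour

section SubtourLP

variable {n : ℕ}

lemma sum_range_split (hn : 3 ≤ n) {M : Type*} [AddCommMonoid M] (f : ℕ → M) :
    ∑ i ∈ range (n - 1), f i = f 0 + ∑ i ∈ Ico 1 (n - 2), f i + f (n - 2) := by
  rw [show n - 1 = n - 2 + 1 by omega, sum_range_succ, range_eq_Ico,
    sum_eq_sum_Ico_succ_bot (by omega)]

lemma SubtourLPFeasible.four_le_cut {x : Fin n × Fin 3 → Fin n × Fin 3 → ℝ}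
    (hx : SubtourLPFeasible n x) (s : Fin n × Fin 3 → Prop) [DecidablePred s]
    (h : ∃ p, s p) (h' : ∃ p, ¬ s p) : 4 ≤ ∑ p, ∑ q, (sw (s p) (s q) : ℝ) * x p q := by
  obtain ⟨hsymm, -, -, hdeg, hsub⟩ := hx
  have h1 := hsub (univ.filter s) (by simpa [Finset.Nonempty] using h) fun hS => by
    obtain ⟨p, hp⟩ := h'
    have hp' := mem_univ p
    rw [← hS, mem_filter] at hp'
    exact hp hp'.2
  have h2 : ∑ p, ∑ q, (if s p then x p q else 0) = 2 * #(univ.filter s) := by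
    simp only [sum_ite_irrel, hdeg, sum_const_zero]
    rw [← sum_filter, sum_const, nsmul_eq_mul, mul_comm]
  have h3 : ∑ p, ∑ q, (if s q then x p q else 0) = 2 * #(univ.filter s) := by
    rw [sum_comm, ← h2]
    exact sum_congr rfl fun p _ => sum_congr rfl fun q _ => by rw [hsymm]
  have h4 : ∑ p ∈ univ.filter s, ∑ q ∈ univ.filter s, x p q =
      ∑ p, ∑ q, (if s p then if s q then x p q else 0 else 0) := by
    simp only [sum_filter, sum_ite_irrel, sum_const_zero]
  have h5 : ∑ p, ∑ q, (sw (s p) (s q) : ℝ) * x p q =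
      ∑ p, ∑ q, (if s p then x p q else 0) + ∑ p, ∑ q, (if s q then x p q else 0) -
        2 * ∑ p, ∑ q, (if s p then if s q then x p q else 0 else 0) := by
    simp only [mul_sum, ← sum_add_distrib, ← sum_sub_distrib]
    refine sum_congr rfl fun p _ => sum_congr rfl fun q _ => ?_
    by_cases hp : s p <;> by_cases hq : s q <;> simp [sw, hp, hq]
    ring
  rw [h5, h2, h3, ← h4]
  linarith

/-- The number of the two end columns (`0` or `1`) that `c` belongs to. -/
def endInd (n c : ℕ) : ℝ := (if c = 0 then 1 else 0) + (if c = n - 1 then 1 else 0)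

/-- The dual weights of the single points. -/
def dualPt (n : ℕ) (e : ℝ) (p : Fin n × Fin 3) : ℝ :=
  if (p.2 : ℕ) = 1 then 1 / 2 - e / 2 * endInd n p.1 else (1 - e) / 2 + e * endInd n p.1

/-- The points of the middle row outside the end columns. -/
def IsInner (n : ℕ) (p : Fin n × Fin 3) : Prop := (p.2 : ℕ) = 1 ∧ 1 ≤ (p.1 : ℕ) ∧ (p.1 : ℕ) < n - 1

instance : DecidablePred (IsInner n) := fun _ => inferInstanceAs (Decidable (_ ∧ _))

/-- The coverage of a pair of points by the prefixes and suffixes of row `r`. -/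
def segCover (n r : ℕ) (p q : Fin n × Fin 3) : ℝ :=
  ∑ i ∈ Ico 1 (n - 2),
    ((sw ((p.2 : ℕ) = r ∧ (p.1 : ℕ) ≤ i) ((q.2 : ℕ) = r ∧ (q.1 : ℕ) ≤ i) : ℝ) +
      sw ((p.2 : ℕ) = r ∧ i < (p.1 : ℕ)) ((q.2 : ℕ) = r ∧ i < (q.1 : ℕ)))

/-- The coverage of a pair of points by the dual solution. -/
def dualCover (n : ℕ) (d e : ℝ) (p q : Fin n × Fin 3) : ℝ :=
  dualPt n e p + dualPt n e q +
    (d - 1 - (n - 3) * e / 2) * (sw ((p.2 : ℕ) = 0) ((q.2 : ℕ) = 0) +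
      sw ((p.2 : ℕ) = 2) ((q.2 : ℕ) = 2)) +
    e / 2 * sw (IsInner n p) (IsInner n q) + e / 2 * (segCover n 0 p q + segCover n 2 p q)

lemma segCover_of_ne (hn : 3 ≤ n) {r : ℕ} {p q : Fin n × Fin 3}
    (h : ¬((p.2 : ℕ) = r ↔ (q.2 : ℕ) = r)) : segCover n r p q = n - 3 := by
  have : ∀ i ∈ Ico 1 (n - 2),
      ((sw ((p.2 : ℕ) = r ∧ (p.1 : ℕ) ≤ i) ((q.2 : ℕ) = r ∧ (q.1 : ℕ) ≤ i) : ℝ) +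
      sw ((p.2 : ℕ) = r ∧ i < (p.1 : ℕ)) ((q.2 : ℕ) = r ∧ i < (q.1 : ℕ))) = 1 := by
    intro i _
    norm_cast
    simp only [sw]
    split_ifs <;> omega
  rw [segCover, sum_congr rfl this, sum_const, Nat.card_Ico, nsmul_one,
    show n - 2 - 1 = n - 3 by omega, Nat.cast_sub hn]
  simp

lemma segCover_of_not {r : ℕ} {p q : Fin n × Fin 3} (hp : (p.2 : ℕ) ≠ r) (hq : (q.2 : ℕ) ≠ r) :
    segCover n r p q = 0 := by
  simp [segCover, sw, hp, hq]

lemma segCover_of_eq (hn : 3 ≤ n) {r : ℕ} {p q : Fin n × Fin 3} (hp : (p.2 : ℕ) = r)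
    (hq : (q.2 : ℕ) = r) (hpq : (p.1 : ℕ) ≠ q.1) :
    segCover n r p q = 2 * (|((p.1 : ℕ) : ℝ) - (q.1 : ℕ)| - endInd n p.1 - endInd n q.1) := by
  have h1 : ∀ i ∈ Ico 1 (n - 2),
      ((sw ((p.2 : ℕ) = r ∧ (p.1 : ℕ) ≤ i) ((q.2 : ℕ) = r ∧ (q.1 : ℕ) ≤ i) : ℝ) +
      sw ((p.2 : ℕ) = r ∧ i < (p.1 : ℕ)) ((q.2 : ℕ) = r ∧ i < (q.1 : ℕ))) =
      2 * (sw ((p.1 : ℕ) ≤ i) ((q.1 : ℕ) ≤ i) : ℝ) := by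
    intro i _
    norm_cast
    simp only [sw]
    split_ifs <;> omega
  have h2 := sum_sw_le p.1 q.1 n p.1.2 q.1.2
  rw [sum_range_split hn] at h2
  have h3 : (sw ((p.1 : ℕ) ≤ 0) ((q.1 : ℕ) ≤ 0) : ℝ) =
      (if (p.1 : ℕ) = 0 then 1 else 0) + (if (q.1 : ℕ) = 0 then 1 else 0) := by
    norm_cast
    simp only [sw]
    split_ifs <;> omega
  have h4 : (sw ((p.1 : ℕ) ≤ n - 2) ((q.1 : ℕ) ≤ n - 2) : ℝ) =
      (if (p.1 : ℕ) = n - 1 then 1 else 0) + (if (q.1 : ℕ) = n - 1 then 1 else 0) := by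
    have := p.1.2
    have := q.1.2
    norm_cast
    simp only [sw]
    split_ifs <;> omega
  rw [segCover, sum_congr rfl h1, ← mul_sum, ← h2, h3, h4, endInd, endInd]
  ring

lemma endInd_le_one (hn : 3 ≤ n) (c : ℕ) : endInd n c ≤ 1 := by
  unfold endInd
  split_ifs <;> first | omega | norm_num

lemma endInd_eq (hn : 3 ≤ n) {p : Fin n × Fin 3} (hp : (p.2 : ℕ) = 1) :
    endInd n p.1 = if IsInner n p then 0 else 1 := by
  have := p.1.2
  simp only [endInd, IsInner, hp, true_and]
  split_ifs <;> first | omega | norm_num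

lemma one_le_abs_natCast_sub {a b : ℕ} (h : a ≠ b) : 1 ≤ |(a : ℝ) - b| :=
  one_le_sq_iff_one_le_abs _ |>.1 (one_le_sq_natCast_sub h)

section Cover

variable {d e : ℝ} {p q : Fin n × Fin 3}

lemma sw_comm (a b : Prop) [Decidable a] [Decidable b] : sw a b = sw b a := by
  simp only [sw, iff_comm]

lemma dualCover_comm (p q : Fin n × Fin 3) : dualCover n d e p q = dualCover n d e q p := by
  have h : ∀ r, segCover n r p q = segCover n r q p := fun r =>
    sum_congr rfl fun i _ => by rw [sw_comm, sw_comm (_ ∧ i < _)]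
  rw [dualCover, dualCover, h, h, sw_comm (IsInner n p), sw_comm (_ = 0), sw_comm (_ = 2)]
  ring

lemma dualCover_le_of_row_eq (hn : 3 ≤ n) (he0 : 0 ≤ e) (he1 : e ≤ 1)
    (hr : (p.2 : ℕ) = q.2) (hpq : (p.1 : ℕ) ≠ q.1) :
    dualCover n d e p q ≤ |((p.1 : ℕ) : ℝ) - (q.1 : ℕ)| := by
  have habs := one_le_abs_natCast_sub hpq
  have hswap : ∀ r, sw ((p.2 : ℕ) = r) ((q.2 : ℕ) = r) = 0 := fun r => by simp [sw, hr]
  rw [dualCover, hswap, hswap]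
  by_cases h1 : (q.2 : ℕ) = 1
  · rw [segCover_of_not (by omega) (by omega), segCover_of_not (by omega) (by omega), dualPt,
      dualPt, if_pos (hr.trans h1), if_pos h1, endInd_eq hn (hr.trans h1), endInd_eq hn h1]
    by_cases hp : IsInner n p <;> by_cases hq : IsInner n q <;> simp only [sw, hp, hq] <;>
      norm_num <;> linarith
  · have hIp : ¬ IsInner n p := fun h => h1 (hr ▸ h.1)
    have hIq : ¬ IsInner n q := fun h => h1 h.1
    have hseg : segCover n 0 p q + segCover n 2 p q =
        2 * (|((p.1 : ℕ) : ℝ) - (q.1 : ℕ)| - endInd n p.1 - endInd n q.1) := by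
      have h3 : (q.2 : ℕ) = 0 ∨ (q.2 : ℕ) = 2 := by have := q.2.2; omega
      rcases h3 with h3 | h3
      · rw [segCover_of_eq hn (hr.trans h3) h3 hpq, segCover_of_not (by omega) (by omega), add_zero]
      · rw [segCover_of_eq hn (hr.trans h3) h3 hpq, segCover_of_not (by omega) (by omega), zero_add]
    rw [hseg, dualPt, dualPt, if_neg (hr ▸ h1), if_neg h1]
    simp only [sw, hIp, hIq, if_true, Nat.cast_zero]
    nlinarith [mul_nonneg (sub_nonneg.2 he1) (sub_nonneg.2 habs)]

lemma dualCover_le_of_outer_mid (hn : 3 ≤ n) (he0 : 0 ≤ e) (hp : (p.2 : ℕ) ≠ 1)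
    (hq : (q.2 : ℕ) = 1) : dualCover n d e p q ≤ if (p.1 : ℕ) = q.1 then d else d + e := by
  have hIp : ¬ IsInner n p := fun h => hp h.1
  have hsum : ((sw ((p.2 : ℕ) = 0) ((q.2 : ℕ) = 0) : ℝ) + sw ((p.2 : ℕ) = 2) ((q.2 : ℕ) = 2)) = 1 ∧
      segCover n 0 p q + segCover n 2 p q = n - 3 := by
    have h3 : (p.2 : ℕ) = 0 ∨ (p.2 : ℕ) = 2 := by have := p.2.2; omega
    rcases h3 with h3 | h3
    · rw [segCover_of_ne hn (by omega), segCover_of_not (by omega) (by omega)]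
      simp [sw, h3, hq]
    · rw [segCover_of_not (by omega) (by omega), segCover_of_ne hn (by omega)]
      simp [sw, h3, hq]
  rw [dualCover, hsum.1, hsum.2, dualPt, dualPt, if_neg hp, if_pos hq]
  have hend := endInd_le_one hn p.1
  have hend' := mul_le_mul_of_nonneg_left hend he0
  rw [endInd_eq hn hq]
  have hsw : (sw (IsInner n p) (IsInner n q) : ℝ) = if IsInner n q then 1 else 0 := by
    simp [sw, hIp]
  rw [hsw]
  by_cases hIq : IsInner n q
  · rw [if_pos hIq, if_pos hIq]
    split_ifs with h
    · have : endInd n p.1 = 0 := by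
        have := hIq.2
        rw [← h] at this
        rw [endInd, if_neg (by omega), if_neg (by omega), add_zero]
      rw [this]
      linarith
    · linarith
  · rw [if_neg hIq, if_neg hIq]
    split_ifs <;> linarith

lemma dualCover_le_of_outer_outer (hn : 3 ≤ n) (he0 : 0 ≤ e) (he1 : e ≤ 1)
    (hp : (p.2 : ℕ) = 0) (hq : (q.2 : ℕ) = 2) : dualCover n d e p q ≤ 2 * d := by
  have hIp : ¬ IsInner n p := fun h => by have := h.1; omega
  have hIq : ¬ IsInner n q := fun h => by have := h.1; omega
  rw [dualCover, segCover_of_ne hn (by omega), segCover_of_ne hn (by omega), dualPt, dualPt,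
    if_neg (by omega), if_neg (by omega)]
  simp only [sw, hIp, hIq, hp, hq]
  have h1 := mul_le_mul_of_nonneg_left (endInd_le_one hn p.1) he0
  have h2 := mul_le_mul_of_nonneg_left (endInd_le_one hn q.1) he0
  norm_num
  linarith

lemma dualCover_le_eucl (hn : 3 ≤ n) (he0 : 0 ≤ e) (he1 : e ≤ 1)
    (hde : (d + e) ^ 2 = 1 + d ^ 2) (hpq : p ≠ q) :
    dualCover n d e p q ≤ eucl (pt n d p) (pt n d q) := by
  have hmid : ∀ p q : Fin n × Fin 3, (p.2 : ℕ) ≠ 1 → (q.2 : ℕ) = 1 →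
      dualCover n d e p q ≤ eucl (pt n d p) (pt n d q) := by
    intro p q hp hq
    refine (dualCover_le_of_outer_mid hn he0 hp hq).trans ?_
    rw [eucl_pt]
    refine Real.le_sqrt_of_sq_le ?_
    rw [mul_pow]
    have h1 := mul_le_mul_of_nonneg_right (one_le_sq_natCast_sub (hp.trans_eq hq.symm)) (sq_nonneg d)
    split_ifs with h
    · nlinarith [sq_nonneg (((p.1 : ℕ) : ℝ) - (q.1 : ℕ))]
    · have := one_le_sq_natCast_sub h
      linarith
  have houter : ∀ p q : Fin n × Fin 3, (p.2 : ℕ) = 0 → (q.2 : ℕ) = 2 →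
      dualCover n d e p q ≤ eucl (pt n d p) (pt n d q) := by
    intro p q hp hq
    refine (dualCover_le_of_outer_outer hn he0 he1 hp hq).trans ?_
    rw [eucl_pt, hp, hq]
    refine Real.le_sqrt_of_sq_le ?_
    push_cast
    nlinarith [sq_nonneg (((p.1 : ℕ) : ℝ) - (q.1 : ℕ))]
  have hcomm : eucl (pt n d p) (pt n d q) = eucl (pt n d q) (pt n d p) := by
    rw [eucl, eucl]
    congr 1
    ring
  by_cases hr : (p.2 : ℕ) = q.2
  · have hne : (p.1 : ℕ) ≠ q.1 := fun h => hpq (Prod.ext (Fin.ext h) (Fin.ext hr))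
    refine (dualCover_le_of_row_eq hn he0 he1 hr hne).trans ?_
    rw [eucl_pt]
    exact Real.abs_le_sqrt (le_add_of_nonneg_right (sq_nonneg _))
  · by_cases hp : (p.2 : ℕ) = 1
    · rw [dualCover_comm, hcomm]
      exact hmid q p (by omega) hp
    · by_cases hq : (q.2 : ℕ) = 1
      · exact hmid p q hp hq
      · have := p.2.2
        have := q.2.2
        by_cases hp0 : (p.2 : ℕ) = 0
        · exact houter p q hp0 (by omega)
        · rw [dualCover_comm, hcomm]
          exact houter q p (by omega) (by omega)

lemma sum_dualPt (hn : 3 ≤ n) : ∑ p, dualPt n e p = n * (3 / 2 - e) + 3 * e := by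
  have hend : ∑ c : Fin n, endInd n c = 2 := by
    rw [Fin.sum_univ_eq_sum_range (fun c => endInd n c) n]
    simp only [endInd, sum_add_distrib, sum_ite_eq', mem_range]
    rw [if_pos (by omega), if_pos (by omega)]
    norm_num
  rw [Fintype.sum_prod_type]
  simp only [Fin.sum_univ_three, dualPt, Fin.val_zero, Fin.val_one, Fin.val_two]
  norm_num [sum_add_distrib, ← mul_sum, hend]
  ring

lemma SubtourLPFeasible.le_lpValue {x : Fin n × Fin 3 → Fin n × Fin 3 → ℝ}
    (hx : SubtourLPFeasible n x) (hn : 3 ≤ n) (he0 : 0 ≤ e) (he1 : e ≤ 1)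
    (hde : (d + e) ^ 2 = 1 + d ^ 2) (hs : 0 ≤ d - 1 - (n - 3) * e / 2) :
    3 * n - 4 + 4 * d + e ≤ lpValue n d x := by
  have hcover : ∑ p, ∑ q, dualCover n d e p q * x p q ≤
      ∑ p, ∑ q, eucl (pt n d p) (pt n d q) * x p q := by
    refine sum_le_sum fun p _ => sum_le_sum fun q _ => ?_
    by_cases h : p = q
    · rw [h, hx.2.1 q]
      simp
    · exact mul_le_mul_of_nonneg_right (dualCover_le_eucl hn he0 he1 hde h) (hx.2.2.1 p q).1
  have hcut : ∀ (s : Fin n × Fin 3 → Prop) [DecidablePred s] (p q : Fin n × Fin 3), s p → ¬ s q →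
      4 ≤ ∑ p, ∑ q, (sw (s p) (s q) : ℝ) * x p q :=
    fun s _ p q hp hq => hx.four_le_cut s ⟨p, hp⟩ ⟨q, hq⟩
  let v : ∀ c < n, Fin 3 → Fin n × Fin 3 := fun c hc r => (⟨c, hc⟩, r)
  have hpt : ∑ p, ∑ q, (dualPt n e p + dualPt n e q) * x p q = 4 * ∑ p, dualPt n e p := by
    simp only [add_mul, sum_add_distrib]
    rw [sum_comm (f := fun p q => dualPt n e q * x p q)]
    simp only [← mul_sum, hx.2.2.2.1, fun q : Fin n × Fin 3 =>
      (sum_congr rfl fun p _ => hx.1 p q : ∑ p, x p q = ∑ p, x q p), ← sum_mul]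
    ring
  have hseg : ∀ r : Fin 3, 8 * ((n : ℝ) - 3) ≤ ∑ p, ∑ q, segCover n r p q * x p q := by
    intro r
    have h1 : ∑ p, ∑ q, segCover n r p q * x p q = ∑ i ∈ Ico 1 (n - 2),
        (∑ p : Fin n × Fin 3, ∑ q : Fin n × Fin 3,
          (sw ((p.2 : ℕ) = r ∧ (p.1 : ℕ) ≤ i) ((q.2 : ℕ) = r ∧ (q.1 : ℕ) ≤ i) : ℝ) * x p q +
         ∑ p : Fin n × Fin 3, ∑ q : Fin n × Fin 3,
          (sw ((p.2 : ℕ) = r ∧ i < (p.1 : ℕ)) ((q.2 : ℕ) = r ∧ i < (q.1 : ℕ)) : ℝ) * x p q) := by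
      simp only [segCover, ← sum_add_distrib, sum_mul, add_mul]
      exact (sum_congr rfl fun p _ => sum_comm).trans sum_comm
    rw [h1]
    refine le_trans (le_of_eq ?_) (card_nsmul_le_sum _ _ 8 fun i hi => ?_)
    · rw [Nat.card_Ico, nsmul_eq_mul, show n - 2 - 1 = n - 3 by omega, Nat.cast_sub hn, mul_comm]
      simp
    · rw [mem_Ico] at hi
      have h3 := hcut (fun p => (p.2 : ℕ) = r ∧ (p.1 : ℕ) ≤ i) (v 0 (by omega) r)
        (v (n - 1) (by omega) r) (by simp [v]) (by simp [v]; omega)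
      have h4 := hcut (fun p => (p.2 : ℕ) = r ∧ i < (p.1 : ℕ)) (v (n - 1) (by omega) r)
        (v 0 (by omega) r) (by simp [v]; omega) (by simp [v])
      exact (by norm_num : (8 : ℝ) = 4 + 4).trans_le (add_le_add h3 h4)
  have h0 := hcut (fun p => (p.2 : ℕ) = 0) (v 0 (by omega) 0) (v 0 (by omega) 1) (by simp [v])
    (by simp [v])
  have h2 := hcut (fun p => (p.2 : ℕ) = 2) (v 0 (by omega) 2) (v 0 (by omega) 1) (by simp [v])
    (by simp [v])
  have hI := hcut (IsInner n) (v 1 (by omega) 1) (v 0 (by omega) 1) (by simp [v, IsInner]; omega)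
    (by simp [v, IsInner])
  have hs0 := hseg 0
  have hs2 := hseg 2
  have hexp : ∑ p, ∑ q, dualCover n d e p q * x p q =
      ∑ p, ∑ q, (dualPt n e p + dualPt n e q) * x p q +
      (d - 1 - (n - 3) * e / 2) *
        (∑ p : Fin n × Fin 3, ∑ q : Fin n × Fin 3, (sw ((p.2 : ℕ) = 0) ((q.2 : ℕ) = 0) : ℝ) * x p q
        + ∑ p : Fin n × Fin 3, ∑ q : Fin n × Fin 3,
          (sw ((p.2 : ℕ) = 2) ((q.2 : ℕ) = 2) : ℝ) * x p q) +
      e / 2 * ∑ p, ∑ q, (sw (IsInner n p) (IsInner n q) : ℝ) * x p q +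
      e / 2 * (∑ p, ∑ q, segCover n 0 p q * x p q + ∑ p, ∑ q, segCover n 2 p q * x p q) := by
    simp only [mul_sum, ← sum_add_distrib]
    refine sum_congr rfl fun p _ => sum_congr rfl fun q _ => ?_
    rw [dualCover]
    ring
  rw [hpt, sum_dualPt hn] at hexp
  have hA := mul_le_mul_of_nonneg_left (add_le_add h0 h2) hs
  have hB := mul_le_mul_of_nonneg_left hI (by linarith : 0 ≤ e / 2)
  have hC := mul_le_mul_of_nonneg_left (add_le_add hs0 hs2) (by linarith : 0 ≤ e / 2)
  simp only [Fin.val_zero, Fin.val_two] at hC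
  rw [lpValue]
  linarith

end Cover

end SubtourLP

section EdgeMatrix

variable {n : ℕ} {ι V : Type*} [Fintype ι] [DecidableEq V] {w : ι → ℝ} {a b : ι → V}

/-- The symmetric matrix of edge variables of a graph with edges `a i`, `b i` of weight `w i`. -/
def edgeMat (w : ι → ℝ) (a b : ι → V) (p q : V) : ℝ :=
  ∑ i, w i * ((if a i = p ∧ b i = q then 1 else 0) + (if b i = p ∧ a i = q then 1 else 0))

lemma edgeMat_comm (p q : V) : edgeMat w a b p q = edgeMat w a b q p :=
  sum_congr rfl fun i _ => by rw [add_comm]; simp only [and_comm]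

lemma edgeMat_nonneg (hw : ∀ i, 0 ≤ w i) (p q : V) : 0 ≤ edgeMat w a b p q := by
  refine sum_nonneg fun i _ => mul_nonneg (hw i) ?_
  split_ifs <;> norm_num

lemma edgeMat_self (hab : ∀ i, a i ≠ b i) (p : V) : edgeMat w a b p p = 0 := by
  refine sum_eq_zero fun i _ => ?_
  rw [if_neg fun h => hab i (h.1.trans h.2.symm), if_neg fun h => hab i (h.2.trans h.1.symm)]
  simp

lemma sum_mul_edgeMat [Fintype V] (F : V → V → ℝ) :
    ∑ p, ∑ q, F p q * edgeMat w a b p q = ∑ i, w i * (F (a i) (b i) + F (b i) (a i)) := by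
  have h : ∀ u v : V, ∑ p, ∑ q, F p q * (if u = p ∧ v = q then 1 else 0) = F u v := fun u v => by
    simp [ite_and]
  simp only [edgeMat, mul_sum]
  rw [sum_congr rfl fun p _ => sum_comm, sum_comm]
  refine sum_congr rfl fun i _ => ?_
  rw [← h (a i), ← h (b i)]
  simp only [mul_add, mul_sum, ← sum_add_distrib]
  exact sum_congr rfl fun p _ => sum_congr rfl fun q _ => by ring

lemma sum_edgeMat [Fintype V] (p : V) : ∑ q, edgeMat w a b p q =
    ∑ i, w i * ((if a i = p then 1 else 0) + (if b i = p then 1 else 0)) := by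
  rw [← sum_mul_edgeMat fun u _ => if u = p then 1 else 0]
  simp

lemma subtourLPFeasible_edgeMat {a b : ι → Fin n × Fin 3} (hw : ∀ i, 0 ≤ w i)
    (hab : ∀ i, a i ≠ b i)
    (hdeg : ∀ v, ∑ i, w i * ((if a i = v then 1 else 0) + (if b i = v then 1 else 0)) = 2)
    (hcut : ∀ (s : Fin n × Fin 3 → Prop) [DecidablePred s], (∃ p, s p) → (∃ p, ¬ s p) →
      2 ≤ ∑ i, w i * (sw (s (a i)) (s (b i)) : ℝ)) :
    SubtourLPFeasible n (edgeMat w a b) := by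
  have hsub : ∀ S : Finset (Fin n × Fin 3), S.Nonempty → S ≠ univ →
      ∑ p ∈ S, ∑ q ∈ S, edgeMat w a b p q ≤ 2 * ((#S : ℝ) - 1) := by
    intro S hS hS'
    have h1 : ∑ p ∈ S, ∑ q ∈ S, edgeMat w a b p q =
        ∑ i, w i * (2 * if a i ∈ S ∧ b i ∈ S then 1 else 0) := by
      have := sum_mul_edgeMat (w := w) (a := a) (b := b)
        fun p q => if p ∈ S ∧ q ∈ S then 1 else 0
      simp only [and_comm (a := b _ ∈ S), ← two_mul] at this
      rw [← this]
      simp only [ite_and, ite_mul, one_mul, zero_mul, sum_ite_irrel, sum_const_zero, sum_ite_mem,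
        univ_inter]
    have h2 : 2 * (#S : ℝ) =
        ∑ i, w i * ((if a i ∈ S then 1 else 0) + (if b i ∈ S then 1 else 0)) := by
      rw [mul_comm, ← nsmul_eq_mul, ← sum_const, ← sum_congr rfl fun v _ => hdeg v, sum_comm]
      simp only [← mul_sum, sum_add_distrib, sum_ite_eq]
    have h3 := hcut (· ∈ S) hS (by
      by_contra! h
      exact hS' (eq_univ_iff_forall.2 h))
    rw [h1, mul_sub, h2, le_sub_iff_add_le, mul_one]
    refine (add_le_add_right h3 _).trans (le_of_eq ?_)
    rw [← sum_add_distrib]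
    refine sum_congr rfl fun i _ => ?_
    by_cases ha : a i ∈ S <;> by_cases hb : b i ∈ S <;> simp [sw, ha, hb, mul_comm, one_add_one_eq_two]
  refine ⟨edgeMat_comm, edgeMat_self hab, fun p q => ⟨edgeMat_nonneg hw p q, ?_⟩,
    fun v => (sum_edgeMat v).trans (hdeg v), hsub⟩
  by_cases h : p = q
  · rw [h, edgeMat_self hab]
    exact zero_le_one
  · have h1 := hsub {p, q} (insert_nonempty _ _) fun h1 => by
      have h2 := congrArg card h1
      rw [card_pair h, card_univ, Fintype.card_prod, Fintype.card_fin, Fintype.card_fin] at h2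
      omega
    rw [sum_pair h, sum_pair h, sum_pair h, edgeMat_self hab, edgeMat_self hab, edgeMat_comm q p,
      card_pair h] at h1
    push_cast at h1
    linarith

end EdgeMatrix

section Solution

variable {n : ℕ}

/-- The weights of the edges of an optimum solution. -/
def solWeight (n : ℕ) : (Fin (n - 1) × Fin 3) ⊕ Fin 6 → ℝ
  | .inl (i, r) => if r = 1 ∧ ((i : ℕ) = 0 ∨ (i : ℕ) = n - 2) then 1 / 2 else 1
  | .inr k => ![1, 1 / 2, 1 / 2, 1, 1 / 2, 1 / 2] k

/-- The first endpoints of the edges of an optimum solution. -/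
def solFst (n : ℕ) : (Fin (n - 1) × Fin 3) ⊕ Fin 6 → ℕ × Fin 3
  | .inl (i, r) => (i, r)
  | .inr k => ![(0, 0), (0, 2), (0, 2), (n - 1, 0), (n - 1, 2), (n - 1, 2)] k

/-- The second endpoints of the edges of an optimum solution. -/
def solSnd (n : ℕ) : (Fin (n - 1) × Fin 3) ⊕ Fin 6 → ℕ × Fin 3
  | .inl (i, r) => (i + 1, r)
  | .inr k => ![(0, 1), (0, 1), (1, 1), (n - 1, 1), (n - 1, 1), (n - 2, 1)] k

/-- The grid point with column `u.1` (read modulo `n`) and row `u.2`. -/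
def gridPt (hn : 0 < n) (u : ℕ × Fin 3) : Fin n × Fin 3 := (⟨u.1 % n, Nat.mod_lt _ hn⟩, u.2)

lemma gridPt_eq_iff (hn : 0 < n) {u : ℕ × Fin 3} (hu : u.1 < n) {v : Fin n × Fin 3} :
    gridPt hn u = v ↔ u = ((v.1 : ℕ), v.2) := by
  simp [gridPt, Prod.ext_iff, Fin.ext_iff, Nat.mod_eq_of_lt hu]

lemma solFst_lt (hn : 4 ≤ n) (i) : (solFst n i).1 < n := by
  rcases i with ⟨i, r⟩ | k
  · exact i.2.trans_le (Nat.sub_le _ _)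
  · fin_cases k <;> simp [solFst] <;> omega

lemma solSnd_lt (hn : 4 ≤ n) (i) : (solSnd n i).1 < n := by
  rcases i with ⟨i, r⟩ | k
  · have := i.2
    simp only [solSnd]
    omega
  · fin_cases k <;> simp [solSnd] <;> omega

lemma solFst_ne_solSnd (i) : solFst n i ≠ solSnd n i := by
  rcases i with ⟨i, r⟩ | k
  · simp [solFst, solSnd]
  · fin_cases k <;> simp [solFst, solSnd]

lemma solWeight_nonneg (i) : 0 ≤ solWeight n i := by
  rcases i with ⟨i, r⟩ | k
  · simp only [solWeight]
    split_ifs <;> norm_num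
  · fin_cases k <;> simp [solWeight]

lemma sum_solWeight_mul (hn : 4 ≤ n) (G : ℕ × Fin 3 → ℕ × Fin 3 → ℝ) :
    ∑ i, solWeight n i * G (solFst n i) (solSnd n i) =
      ∑ i ∈ range (n - 1), G (i, 0) (i + 1, 0) + ∑ i ∈ range (n - 1), G (i, 2) (i + 1, 2) +
      (1 / 2 * G (0, 1) (1, 1) + ∑ i ∈ Ico 1 (n - 2), G (i, 1) (i + 1, 1) +
        1 / 2 * G (n - 2, 1) (n - 1, 1)) +
      (G (0, 0) (0, 1) + 1 / 2 * G (0, 2) (0, 1) + 1 / 2 * G (0, 2) (1, 1)) +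
      (G (n - 1, 0) (n - 1, 1) + 1 / 2 * G (n - 1, 2) (n - 1, 1) +
        1 / 2 * G (n - 1, 2) (n - 2, 1)) := by
  have h1 : ∑ i ∈ range (n - 1), (if i = 0 ∨ i = n - 2 then (1 / 2 : ℝ) else 1) *
      G (i, 1) (i + 1, 1) = 1 / 2 * G (0, 1) (1, 1) + ∑ i ∈ Ico 1 (n - 2), G (i, 1) (i + 1, 1) +
        1 / 2 * G (n - 2, 1) (n - 1, 1) := by
    rw [sum_range_split (by omega), if_pos (Or.inl rfl), if_pos (Or.inr rfl),
      show n - 2 + 1 = n - 1 by omega]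
    congr 2
    refine sum_congr rfl fun i hi => ?_
    rw [mem_Ico] at hi
    rw [if_neg (by omega), one_mul]
  rw [Fintype.sum_sum_type, Fintype.sum_prod_type, ← h1]
  simp only [Fin.sum_univ_three, Fin.sum_univ_six, solWeight, solFst, solSnd, sum_add_distrib,
    true_and, Fin.reduceEq, false_and, if_false, one_mul]
  rw [Fin.sum_univ_eq_sum_range fun i => G (i, 0) (i + 1, 0),
    Fin.sum_univ_eq_sum_range fun i => G (i, 2) (i + 1, 2),
    Fin.sum_univ_eq_sum_range fun i => (if i = 0 ∨ i = n - 2 then (1 / 2 : ℝ) else 1) *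
      G (i, 1) (i + 1, 1)]
  simp
  ring

lemma sum_Ico_ite_eq (a b c : ℕ) :
    ∑ i ∈ Ico a b, (if i = c then (1 : ℝ) else 0) = if a ≤ c ∧ c < b then 1 else 0 := by
  simp

lemma sum_Ico_ite_succ_eq (a b c : ℕ) :
    ∑ i ∈ Ico a b, (if i + 1 = c then (1 : ℝ) else 0) = if a + 1 ≤ c ∧ c < b + 1 then 1 else 0 := by
  rw [sum_Ico_add' (fun i => if i = c then (1 : ℝ) else 0), sum_Ico_ite_eq]

lemma sol_degree (hn : 4 ≤ n) (v : ℕ × Fin 3) (hv : v.1 < n) : ∑ i, solWeight n i *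
    ((if solFst n i = v then 1 else 0) + (if solSnd n i = v then 1 else 0)) = 2 := by
  rw [sum_solWeight_mul hn fun x y => (if x = v then 1 else 0) + (if y = v then 1 else 0)]
  obtain ⟨c, r⟩ := v
  have hr : r = 0 ∨ r = 1 ∨ r = 2 := by fin_cases r <;> simp
  have hc : c < n := hv
  rcases hr with rfl | rfl | rfl <;>
    simp only [Prod.mk.injEq, range_eq_Ico, sum_add_distrib, and_true, sum_Ico_ite_eq,
      sum_Ico_ite_succ_eq, Fin.reduceEq, and_false, if_false, sum_const_zero] <;>
    split_ifs <;> first | omega | norm_num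

set_option synthInstance.maxSize 4000 in
lemma four_le_of_not_const : ∀ a a' b b' c c' e e' : Bool,
    ¬(a' = a ∧ b = a ∧ b' = a ∧ c = a ∧ c' = a ∧ e = a ∧ e' = a) →
    4 ≤ 2 * sw a a' + 2 * sw b b' + 2 * sw c c' + sw e c + sw c' e' +
      (2 * sw a e + sw b e + sw b c) + (2 * sw a' e' + sw b' e' + sw b' c') := by
  decide

lemma sol_cut (hn : 4 ≤ n) (σ : ℕ × Fin 3 → Prop) [DecidablePred σ] {u : ℕ × Fin 3}
    (hu : u.1 < n) (h : ¬(σ (0, 0) ↔ σ u)) :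
    2 ≤ ∑ i, solWeight n i * (sw (σ (solFst n i)) (σ (solSnd n i)) : ℝ) := by
  rw [sum_solWeight_mul hn fun x y => (sw (σ x) (σ y) : ℝ)]
  have key : 4 ≤ 2 * ∑ i ∈ range (n - 1), sw (σ (i, 0)) (σ (i + 1, 0)) +
      2 * ∑ i ∈ range (n - 1), sw (σ (i, 2)) (σ (i + 1, 2)) +
      2 * ∑ i ∈ Ico 1 (n - 2), sw (σ (i, 1)) (σ (i + 1, 1)) +
      sw (σ (0, 1)) (σ (1, 1)) + sw (σ (n - 2, 1)) (σ (n - 1, 1)) +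
      (2 * sw (σ (0, 0)) (σ (0, 1)) + sw (σ (0, 2)) (σ (0, 1)) + sw (σ (0, 2)) (σ (1, 1))) +
      (2 * sw (σ (n - 1, 0)) (σ (n - 1, 1)) + sw (σ (n - 1, 2)) (σ (n - 1, 1)) +
        sw (σ (n - 1, 2)) (σ (n - 2, 1))) := by
    rw [range_eq_Ico]
    have hle : ∀ (r : Fin 3) {a b : ℕ}, a ≤ b →
        sw (σ (a, r)) (σ (b, r)) ≤ ∑ i ∈ Ico a b, sw (σ (i, r)) (σ (i + 1, r)) := by
      intro r a b hab
      rw [sw]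
      split_ifs with h
      · exact Nat.zero_le _
      · exact one_le_sum_sw (fun i => σ (i, r)) hab h
    by_cases hall : (σ (n - 1, 0) ↔ σ (0, 0)) ∧ (σ (0, 2) ↔ σ (0, 0)) ∧
        (σ (n - 1, 2) ↔ σ (0, 0)) ∧ (σ (1, 1) ↔ σ (0, 0)) ∧ (σ (n - 2, 1) ↔ σ (0, 0)) ∧
        (σ (0, 1) ↔ σ (0, 0)) ∧ (σ (n - 1, 1) ↔ σ (0, 0))
    · obtain ⟨c, r⟩ := u
      obtain ⟨h1, h2, h3, h4, h5, h6, h7⟩ := hall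
      have hc : c ≤ n - 1 := Nat.le_sub_one_of_lt hu
      have hr : r = 0 ∨ r = 1 ∨ r = 2 := by fin_cases r <;> simp
      rcases hr with rfl | rfl | rfl
      · have := two_le_sum_sw (fun i => σ (i, 0)) (Nat.zero_le c) hc h1.symm h
        omega
      · have hc0 : c ≠ 0 := by
          rintro rfl
          exact h h6.symm
        have hc1 : c ≠ n - 1 := by
          rintro rfl
          exact h h7.symm
        have := two_le_sum_sw (fun i => σ (i, 1)) (a := 1) (b := n - 2) (c := c) (by omega)
          (by omega) (h4.trans h5.symm) fun h' => h (h4.symm.trans h')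
        omega
      · have := two_le_sum_sw (fun i => σ (i, 2)) (Nat.zero_le c) hc (h2.trans h3.symm)
          fun h' => h (h2.symm.trans h')
        omega
    · have hfin := four_le_of_not_const (σ (0, 0)) (σ (n - 1, 0)) (σ (0, 2)) (σ (n - 1, 2))
        (σ (1, 1)) (σ (n - 2, 1)) (σ (0, 1)) (σ (n - 1, 1)) (by simpa using hall)
      have hsw : ∀ x y, sw (decide (σ x) = true) (decide (σ y) = true) = sw (σ x) (σ y) :=
        fun x y => by simp [sw]
      simp only [hsw] at hfin
      have h0 := hle 0 (Nat.zero_le (n - 1))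
      have h2 := hle 2 (Nat.zero_le (n - 1))
      have h1 := hle 1 (by omega : 1 ≤ n - 2)
      omega
  have key' := (Nat.cast_le (α := ℝ)).2 key
  push_cast at key'
  linarith

/-- An optimum solution of the subtour LP. -/
def sol (hn : 0 < n) : Fin n × Fin 3 → Fin n × Fin 3 → ℝ :=
  edgeMat (solWeight n) (fun i => gridPt hn (solFst n i)) (fun i => gridPt hn (solSnd n i))

lemma subtourLPFeasible_sol (hn : 4 ≤ n) : SubtourLPFeasible n (sol (by omega : 0 < n)) := by
  refine subtourLPFeasible_edgeMat solWeight_nonneg (fun i h => ?_) (fun v => ?_) ?_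
  · rw [gridPt_eq_iff _ (solFst_lt hn i)] at h
    refine solFst_ne_solSnd i (h.trans ?_)
    simp [gridPt, Nat.mod_eq_of_lt (solSnd_lt hn i)]
  · simp only [gridPt_eq_iff _ (solFst_lt hn _), gridPt_eq_iff _ (solSnd_lt hn _)]
    exact sol_degree hn _ v.1.2
  · rintro s _ ⟨p, hp⟩ ⟨q, hq⟩
    have hgrid : ∀ v : Fin n × Fin 3, gridPt (by omega : 0 < n) ((v.1 : ℕ), v.2) = v := fun v =>
      (gridPt_eq_iff _ v.1.2).2 rfl
    by_cases h0 : s (gridPt (by omega : 0 < n) (0, 0))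
    · exact sol_cut hn (fun u => s (gridPt _ u)) (u := ((q.1 : ℕ), q.2)) q.1.2 (by
        simp [hgrid, h0, hq])
    · exact sol_cut hn (fun u => s (gridPt _ u)) (u := ((p.1 : ℕ), p.2)) p.1.2 (by
        simp [hgrid, h0, hp])

lemma lpValue_sol (hn : 4 ≤ n) {d : ℝ} (hd : 0 ≤ d) :
    lpValue n d (sol (by omega : 0 < n)) = 3 * n - 4 + 3 * d + √(1 + d ^ 2) := by
  have h0 : 0 < n := by omega
  have hlen : ∀ u v : ℕ × Fin 3, u.1 < n → v.1 < n → eucl (pt n d (gridPt h0 u))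
      (pt n d (gridPt h0 v)) =
      √(((u.1 : ℝ) - v.1) ^ 2 + (((u.2 : ℕ) : ℝ) - (v.2 : ℕ)) ^ 2 * d ^ 2) := by
    intro u v hu hv
    rw [eucl_pt]
    simp only [gridPt, Nat.mod_eq_of_lt hu, Nat.mod_eq_of_lt hv]
    congr 1
    ring
  have hsymm : ∀ u v : ℝ × ℝ, eucl u v = eucl v u := fun u v => by
    rw [eucl, eucl]
    congr 1
    ring
  have hG := sum_solWeight_mul hn fun u v =>
    √(((u.1 : ℝ) - v.1) ^ 2 + (((u.2 : ℕ) : ℝ) - (v.2 : ℕ)) ^ 2 * d ^ 2)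
  rw [lpValue, sol, sum_mul_edgeMat]
  simp only [hsymm (pt n d (gridPt h0 (solSnd n _))), ← two_mul,
    hlen _ _ (solFst_lt hn _) (solSnd_lt hn _), mul_left_comm _ (2 : ℝ), ← mul_sum]
  rw [hG]
  have hn2 : ((n - 2 : ℕ) : ℝ) = n - 2 := by
    rw [Nat.cast_sub (by omega)]
    norm_num
  have hn1 : ((n - 1 : ℕ) : ℝ) = n - 1 := by
    rw [Nat.cast_sub (by omega)]
    norm_num
  have hn3 : ((n - 2 - 1 : ℕ) : ℝ) = n - 3 := by
    rw [Nat.cast_sub (by omega), hn2]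
    norm_num
    ring
  have hsq : ((n : ℝ) - 2 - (n - 1)) ^ 2 = 1 := by ring
  have hsq' : ((n : ℝ) - 1 - (n - 2)) ^ 2 = 1 := by ring
  norm_num [hn1, hn2, hn3, hsq, hsq', Real.sqrt_sq hd]
  ring

lemma optLP_eq (hn : 17 ≤ n) :
    optLP n √((n : ℝ) - 1) = 3 * (n : ℝ) - 4 + 3 * √((n : ℝ) - 1) + √(n : ℝ) := by
  have hn' : (17 : ℝ) ≤ n := by exact_mod_cast hn
  have hd2 : √((n : ℝ) - 1) ^ 2 = n - 1 := Real.sq_sqrt (by linarith)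
  have hs2 : √(n : ℝ) ^ 2 = n := Real.sq_sqrt (by linarith)
  have hd4 : 4 ≤ √((n : ℝ) - 1) := Real.le_sqrt_of_sq_le (by linarith)
  have hds : √((n : ℝ) - 1) ≤ √(n : ℝ) := Real.sqrt_le_sqrt (by linarith)
  refine IsLeast.csInf_eq ⟨⟨_, subtourLPFeasible_sol (by omega), ?_⟩, ?_⟩
  · rw [lpValue_sol (by omega) (Real.sqrt_nonneg _), hd2, add_sub_cancel]
  · rintro _ ⟨x, hx, rfl⟩
    generalize √((n : ℝ) - 1) = d at *
    generalize √(n : ℝ) = s at *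
    have hmul : (s - d) * (s + d) = 1 := by linarith
    have he : d * (s - d) ≤ 1 / 2 := by nlinarith
    refine le_trans (le_of_eq ?_) (hx.le_lpValue (e := s - d) (by omega) (by linarith)
      (by nlinarith) ?_ ?_)
    · ring
    · rw [add_sub_cancel]
      linarith
    · have h1 : ((n : ℝ) - 3) * (s - d) ≤ d * (d * (s - d)) := by nlinarith
      nlinarith

end Solution

/-- For even `n ≥ 17`, the integrality ratio of the subtour LP for
`G(n, √(n−1))` equals `(4n − 4 + 2√(n−1)) / (3n − 4 + 3√(n−1) + √n)`. -/
theorem statement15 (n : ℕ) (hn : 17 ≤ n) (hne : Even n) :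
    optTour n (Real.sqrt ((n : ℝ) - 1)) / optLP n (Real.sqrt ((n : ℝ) - 1)) =
      (4 * (n : ℝ) - 4 + 2 * Real.sqrt ((n : ℝ) - 1)) /
        (3 * (n : ℝ) - 4 + 3 * Real.sqrt ((n : ℝ) - 1) + Real.sqrt (n : ℝ)) := by
  rw [optTour_eq hn hne, optLP_eq hn]

end
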